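/- arXiv:2305.00190 — 6 statements merged into one kernel-verified Lean document; each statement's English description precedes it below -/
import Mathlib

section
/- Let A be an invertible real m×m matrix, Q a positive definite real m×m matrix, and I a positive semidefinite real m×m matrix. Then ψ_{A,Q}(I) is positive semidefinite. -/
open Matrix

/-- Information-matrix prediction map of the distributed Kalman filter:
`ψ_{A,Q}(J) = (A⁻¹)ᵀ J A⁻¹ − (A⁻¹)ᵀ J (J + Aᵀ Q⁻¹ A)⁻¹ J A⁻¹`. -/
noncomputable def psi {m : ℕ} (A Q J : Matrix (Fin m) (Fin m) ℝ) :
    Matrix (Fin m) (Fin m) ℝ :=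
  (A⁻¹)ᵀ * J * A⁻¹ - (A⁻¹)ᵀ * J * (J + Aᵀ * Q⁻¹ * A)⁻¹ * J * A⁻¹

/-- If `J` is positive semidefinite and `P` is positive definite, then the Schur-type difference
`J - J (J + P)⁻¹ J` is positive semidefinite. -/
theorem Matrix.PosSemidef.sub_mul_inv_add_mul {n : Type*} [Fintype n] [DecidableEq n]
    {J P : Matrix n n ℝ} (hJ : J.PosSemidef) (hP : P.PosDef) :
    (J - J * (J + P)⁻¹ * J).PosSemidef := by
  have hS : (J + P).PosDef := hP.posSemidef_add hJ
  have hdet : IsUnit (J + P).det := (isUnit_iff_isUnit_det _).1 hS.isUnit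
  have hSi : ((J + P)⁻¹)ᴴ = (J + P)⁻¹ := hS.inv.isHermitian.eq
  have hJh : Jᴴ = J := hJ.isHermitian.eq
  have hinv : (J + P)⁻¹ * (J + P) = 1 := nonsing_inv_mul _ hdet
  have h₁ := hJ.conjTranspose_mul_mul_same (1 - (J + P)⁻¹ * J)
  have h₂ := hP.posSemidef.conjTranspose_mul_mul_same ((J + P)⁻¹ * J)
  convert h₁.add h₂ using 1
  rw [conjTranspose_sub, conjTranspose_mul, hSi, hJh, conjTranspose_one]
  generalize (J + P)⁻¹ = T at hinv ⊢
  have key : J * T * (J + P) * T * J = J * T * J := by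
    rw [mul_assoc J T, hinv, mul_one]
  calc J - J * T * J = J - J * T * J - J * T * J + J * T * (J + P) * T * J := by
        rw [key]; abel
    _ = _ := by noncomm_ring

theorem stmt_2 {m : ℕ} (A Q J : Matrix (Fin m) (Fin m) ℝ)
    (hA : IsUnit A.det) (hQ : Q.PosDef) (hJ : J.PosSemidef) :
    (psi A Q J).PosSemidef := by
  have hP : (Aᵀ * Q⁻¹ * A).PosDef := by
    have h := hQ.inv.conjTranspose_mul_mul_same
      (mulVec_injective_of_isUnit ((isUnit_iff_isUnit_det A).2 hA))
    rwa [conjTranspose_eq_transpose_of_trivial] at h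
  have h := (hJ.sub_mul_inv_add_mul hP).conjTranspose_mul_mul_same A⁻¹
  rw [conjTranspose_eq_transpose_of_trivial] at h
  simpa only [psi, mul_sub, sub_mul, mul_assoc] using h
end

section
/- Let A be an invertible real m×m matrix, Q a positive definite real m×m matrix, I a positive definite real m×m matrix, and γ > 0 a real number such that A⁻¹ Q (A⁻¹)ᵀ ⪯ γ I⁻¹ in the Loewner order. Then ψ_{A,Q}(I) ⪰ (1/(1+γ)) (A⁻¹)ᵀ I A⁻¹. -/
open Matrix

namespace Matrix

/-- Inversion is antitone in the Loewner order on positive definite matrices. -/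
theorem PosDef.posSemidef_inv_sub_inv {n : Type*} [Fintype n] [DecidableEq n]
    {B C : Matrix n n ℝ} (hB : B.PosDef) (hC : C.PosDef) (h : (C - B).PosSemidef) :
    (B⁻¹ - C⁻¹).PosSemidef := by
  let := hB.isUnit.invertible
  let := hC.isUnit.invertible
  have key := PosDef.fromBlocks₁₁ (1 : Matrix n n ℝ) B⁻¹ hC
  have key' := PosDef.fromBlocks₂₂ C (1 : Matrix n n ℝ) hB.inv
  simp only [conjTranspose_one, Matrix.one_mul, Matrix.mul_one, inv_inv_of_invertible] at key key'
  exact key.mp (key'.mpr h)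

end Matrix

theorem stmt_5 {m : ℕ} (A Q J : Matrix (Fin m) (Fin m) ℝ) (γ : ℝ)
    (hA : IsUnit A.det) (hQ : Q.PosDef) (hJ : J.PosDef) (hγ : 0 < γ)
    (hbound : (γ • J⁻¹ - A⁻¹ * Q * (A⁻¹)ᵀ).PosSemidef) :
    (psi A Q J - (1 / (1 + γ)) • ((A⁻¹)ᵀ * J * A⁻¹)).PosSemidef := by
  have hAu : IsUnit A := (isUnit_iff_isUnit_det A).mpr hA
  have hJdet : IsUnit J.det := (isUnit_iff_isUnit_det J).mp hJ.isUnit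
  have hJJ : J⁻¹⁻¹ = J := nonsing_inv_nonsing_inv J hJdet
  set N := A⁻¹ * Q * (A⁻¹)ᵀ with hN
  have hNpos : N.PosDef := by
    have hAinv : IsUnit A⁻¹ := (isUnit_nonsing_inv_iff).mpr hAu
    have := hAinv.posDef_star_right_conjugate_iff.mpr hQ
    simpa [hN, star_eq_conjTranspose] using this
  have hNinv : N⁻¹ = Aᵀ * Q⁻¹ * A := by
    rw [hN, Matrix.mul_inv_rev, Matrix.mul_inv_rev, ← transpose_nonsing_inv,
      nonsing_inv_nonsing_inv A hA, Matrix.mul_assoc]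
  have hinv : (J⁻¹ + N)⁻¹ = J - J * (J + Aᵀ * Q⁻¹ * A)⁻¹ * J := by
    have hunit : IsUnit (N⁻¹ + J) := (hNpos.inv.add hJ).isUnit
    have := add_mul_mul_inv_eq_sub J⁻¹ 1 N 1 hJ.inv.isUnit hNpos.isUnit (by simpa [hJJ] using hunit)
    simpa [hJJ, hNinv, add_comm] using this
  have hγ' : 0 < 1 + γ := by positivity
  have hle : ((1 + γ) • J⁻¹ - (J⁻¹ + N)).PosSemidef := by
    convert hbound using 1
    module
  have hinv_le := (hJ.inv.add hNpos).posSemidef_inv_sub_inv (hJ.inv.smul hγ') hle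
  have hsmul : ((1 + γ) • J⁻¹)⁻¹ = (1 / (1 + γ)) • J := by
    refine inv_eq_left_inv ?_
    rw [smul_mul_smul_comm, mul_nonsing_inv J hJdet, one_div_mul_cancel hγ'.ne', one_smul]
  rw [hinv, hsmul] at hinv_le
  convert hinv_le.conjTranspose_mul_mul_same A⁻¹ using 1
  simp [psi, Matrix.mul_sub, Matrix.sub_mul, Matrix.mul_assoc]
end

section
/- (Lemma 1, part 2.) Let A be an invertible real m×m matrix and Q a positive definite real m×m matrix. For any positive semidefinite real m×m matrix Ĩ, there exists β̂ ∈ (0,1] such that for every positive semidefinite real m×m matrix I with I ⪯ Ĩ, one has ψ_{A,Q}(I) ⪰ β̂ (A⁻¹)ᵀ I A⁻¹. -/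
open Matrix

open scoped MatrixOrder in
/-- A positive definite real matrix dominates a positive multiple of any positive semidefinite
one. -/
theorem Matrix.PosDef.exists_pos_sub_smul_posSemidef {n : Type*} [Fintype n] [DecidableEq n]
    {P B : Matrix n n ℝ} (hP : P.PosDef) (hB : B.PosSemidef) :
    ∃ c : ℝ, 0 < c ∧ (P - c • B).PosSemidef := by
  cases isEmpty_or_nonempty n
  · exact ⟨1, one_pos, .of_dotProduct_mulVec_nonneg (Subsingleton.elim _ _) fun x ↦ by
      simp [dotProduct]⟩
  obtain ⟨r, hr, hrP⟩ := (CFC.exists_pos_algebraMap_le_iff (a := P) hP.isHermitian).2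
    fun x hx ↦ (hP.isHermitian.spectrum_real_eq_range_eigenvalues ▸ hx).elim
      fun i hi ↦ hi ▸ hP.eigenvalues_pos i
  obtain ⟨s, hs⟩ := (Matrix.finite_real_spectrum (A := B)).bddAbove
  have hsB : B ≤ algebraMap ℝ _ (max s 1) := (le_algebraMap_iff_spectrum_le hB.isHermitian).2
    fun x hx ↦ (hs hx).trans (le_max_left _ _)
  have hs0 : 0 < max s 1 := zero_lt_one.trans_le (le_max_right _ _)
  refine ⟨r / max s 1, by positivity, ?_⟩
  have h := (Matrix.le_iff.1 hrP).add
    ((Matrix.le_iff.1 hsB).smul (by positivity : 0 ≤ r / max s 1))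
  have e : P - (r / max s 1) • B = P - algebraMap ℝ (Matrix n n ℝ) r +
      (r / max s 1) • (algebraMap ℝ (Matrix n n ℝ) (max s 1) - B) := by
    rw [Algebra.algebraMap_eq_smul_one, Algebra.algebraMap_eq_smul_one, smul_sub, smul_smul,
      div_mul_cancel₀ _ hs0.ne']
    abel
  rw [e]
  exact h

/-- If `c J ⪯ P` then `J (J + P)⁻¹ J ⪯ (1 + c)⁻¹ J`. -/
theorem Matrix.PosDef.smul_sub_mul_inv_mul_posSemidef {n : Type*} [Fintype n] [DecidableEq n]
    {P J : Matrix n n ℝ} (hP : P.PosDef) (hJ : J.PosSemidef) {c : ℝ} (hc : 0 < c)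
    (h : (P - c • J).PosSemidef) :
    ((1 + c)⁻¹ • J - J * (J + P)⁻¹ * J).PosSemidef := by
  have hM : (J + P).PosDef := hP.posSemidef_add hJ
  have hdet : IsUnit (J + P).det := (Matrix.isUnit_iff_isUnit_det _).1 hM.isUnit
  obtain ⟨K, hK⟩ : ∃ K, K = (J + P)⁻¹ * J := ⟨_, rfl⟩
  have hMK : J * K + P * K = J := by
    rw [hK, ← add_mul, Matrix.mul_nonsing_inv_cancel_left _ _ hdet]
  have hJT : Jᵀ = J := by simpa using hJ.isHermitian.eq
  have hPT : Pᵀ = P := by simpa using hP.isHermitian.eq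
  have hKM : Kᵀ * J + Kᵀ * P = J := by
    simpa [Matrix.transpose_mul, hJT, hPT] using congrArg Matrix.transpose hMK
  have key := ((hJ.conjTranspose_mul_mul_same (1 - (1 + c) • K)).smul
    (by positivity : 0 ≤ (1 + c)⁻¹)).add (h.conjTranspose_mul_mul_same K)
  have hc1 : (1 + c) ≠ 0 := by positivity
  convert key using 1
  have e : Kᵀ * P * K = J * K - Kᵀ * J * K := by
    rw [eq_sub_iff_add_eq'.2 hKM, sub_mul]
  have e' : Kᵀ * J = J * K := by
    have e₁ : Kᵀ * P * K = Kᵀ * J - Kᵀ * J * K := by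
      rw [mul_assoc, eq_sub_iff_add_eq'.2 hMK, mul_sub, mul_assoc]
    exact (sub_left_injective (e.symm.trans e₁)).symm
  rw [mul_assoc, ← hK]
  simp only [Matrix.conjTranspose_eq_transpose_of_trivial, Matrix.transpose_sub,
    Matrix.transpose_one, Matrix.transpose_smul, mul_sub, sub_mul, mul_one, one_mul, e, e',
    Matrix.smul_mul, Matrix.mul_smul, smul_sub, smul_smul, inv_mul_cancel₀ hc1, one_smul]
  match_scalars <;> field_simp <;> ring

theorem stmt_6 {m : ℕ} (A Q Itil : Matrix (Fin m) (Fin m) ℝ)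
    (hA : IsUnit A.det) (hQ : Q.PosDef) (hItil : Itil.PosSemidef) :
    ∃ β : ℝ, β ∈ Set.Ioc (0 : ℝ) 1 ∧
      ∀ J : Matrix (Fin m) (Fin m) ℝ, J.PosSemidef → (Itil - J).PosSemidef →
        (psi A Q J - β • ((A⁻¹)ᵀ * J * A⁻¹)).PosSemidef := by
  have hP : (Aᵀ * Q⁻¹ * A).PosDef := by
    simpa using hQ.inv.conjTranspose_mul_mul_same
      (Matrix.mulVec_injective_of_isUnit ((Matrix.isUnit_iff_isUnit_det A).2 hA))
  obtain ⟨c, hc, hcP⟩ := hP.exists_pos_sub_smul_posSemidef hItil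
  refine ⟨1 - (1 + c)⁻¹, ⟨sub_pos.2 (inv_lt_one_of_one_lt₀ (by linarith)),
    sub_le_self _ (by positivity)⟩, fun J hJ hJI ↦ ?_⟩
  have hcJ : (Aᵀ * Q⁻¹ * A - c • J).PosSemidef := by
    convert hcP.add (hJI.smul hc.le) using 1
    rw [smul_sub]
    abel
  convert (hP.smul_sub_mul_inv_mul_posSemidef hJ hc hcJ).conjTranspose_mul_mul_same A⁻¹ using 1
  simp only [psi, Matrix.conjTranspose_eq_transpose_of_trivial, mul_sub, sub_mul, sub_smul,
    one_smul, Matrix.smul_mul, Matrix.mul_smul, Matrix.mul_assoc]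
  abel
end

section
/- Let A be an invertible real m×m matrix, Q a positive definite real m×m matrix, and I a positive semidefinite real m×m matrix. Then ψ_{A,Q}(I) ⪯ Q⁻¹ in the Loewner order. (Consequently, every information matrix produced by the prediction step of the distributed Kalman filter is uniformly bounded above by Q⁻¹.) -/
open Matrix

/-- Symmetry of the parallel sum: `J - J (J + P)⁻¹ J = P - P (J + P)⁻¹ P`. -/
theorem sub_mul_inv_add_mul_comm {n R : Type*} [Fintype n] [DecidableEq n] [CommRing R]
    (J P : Matrix n n R) (h : IsUnit (J + P).det) :
    J - J * (J + P)⁻¹ * J = P - P * (J + P)⁻¹ * P := by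
  obtain ⟨S, hS⟩ : ∃ S, S = J + P := ⟨_, rfl⟩
  obtain rfl : J = S - P := by simp [hS]
  rw [sub_add_cancel] at h ⊢
  simp only [sub_mul, mul_sub, mul_nonsing_inv _ h, nonsing_inv_mul_cancel_right _ _ h, one_mul]
  abel

/-- The gap between `Q⁻¹` and `psi A Q J` is a congruence of `(J + Aᵀ Q⁻¹ A)⁻¹`. -/
theorem inv_sub_psi {m : ℕ} (A Q J : Matrix (Fin m) (Fin m) ℝ) (hA : IsUnit A.det)
    (h : IsUnit (J + Aᵀ * Q⁻¹ * A).det) :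
    Q⁻¹ - psi A Q J = Q⁻¹ * A * (J + Aᵀ * Q⁻¹ * A)⁻¹ * (Aᵀ * Q⁻¹) := by
  have hAt : (A⁻¹)ᵀ * Aᵀ = 1 := by rw [← transpose_mul, mul_nonsing_inv _ hA, transpose_one]
  have hpsi : psi A Q J = (A⁻¹)ᵀ * (J - J * (J + Aᵀ * Q⁻¹ * A)⁻¹ * J) * A⁻¹ := by
    simp only [psi, mul_sub, sub_mul, Matrix.mul_assoc]
  rw [hpsi, sub_mul_inv_add_mul_comm _ _ h]
  generalize (J + Aᵀ * Q⁻¹ * A)⁻¹ = T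
  have hcancel (X : Matrix (Fin m) (Fin m) ℝ) : (A⁻¹)ᵀ * (Aᵀ * X) = X := by
    rw [← Matrix.mul_assoc, hAt, Matrix.one_mul]
  simp only [mul_sub, sub_mul, Matrix.mul_assoc, hcancel, mul_nonsing_inv _ hA, Matrix.mul_one]
  abel

theorem stmt_7 {m : ℕ} (A Q J : Matrix (Fin m) (Fin m) ℝ)
    (hA : IsUnit A.det) (hQ : Q.PosDef) (hJ : J.PosSemidef) :
    (Q⁻¹ - psi A Q J).PosSemidef := by
  have hP : (Aᵀ * Q⁻¹ * A).PosDef := by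
    have := hQ.inv.conjTranspose_mul_mul_same
      (mulVec_injective_of_isUnit ((isUnit_iff_isUnit_det A).2 hA))
    rwa [conjTranspose_eq_transpose_of_trivial] at this
  have hS : (J + Aᵀ * Q⁻¹ * A).PosDef := hP.posSemidef_add hJ
  have hB : (Aᵀ * Q⁻¹)ᴴ = Q⁻¹ * A := by
    rw [conjTranspose_mul, hQ.inv.isHermitian.eq, conjTranspose_eq_transpose_of_trivial,
      transpose_transpose]
  rw [inv_sub_psi A Q J hA ((isUnit_iff_isUnit_det _).1 hS.isUnit), ← hB]
  exact hS.inv.posSemidef.conjTranspose_mul_mul_same _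
end

section
/- (Comparison principle underlying Theorem 1.) Let A : ℕ → ℝ^{m×m} be a sequence of invertible matrices, Q ∈ ℝ^{m×m} positive definite, and l : ℕ → ℝ^{m×m} a sequence of positive semidefinite matrices. Let I, J : ℕ → ℝ^{m×m} be sequences of positive semidefinite matrices satisfying I₀ ⪯ J₀, I_{k+1} = ψ_{A(k),Q}(I_k + l_k), and J_{k+1} = ψ_{A(k),Q}(J_k + l_k) for all k. Then I_k ⪯ J_k for every k ∈ ℕ. -/
open Matrix

theorem Matrix.PosDef.posSemidef_inv_sub_inv_s9 {n : Type*} [Fintype n] [DecidableEq n]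
    {S T : Matrix n n ℝ} (hS : S.PosDef) (hT : T.PosDef) (h : (T - S).PosSemidef) :
    (S⁻¹ - T⁻¹).PosSemidef := by
  have hSdet : IsUnit S.det := (isUnit_iff_isUnit_det S).1 hS.isUnit
  have hTdet : IsUnit T.det := (isUnit_iff_isUnit_det T).1 hT.isUnit
  have key : S⁻¹ - T⁻¹ = T⁻¹ * ((T - S) + (T - S) * S⁻¹ * (T - S)) * T⁻¹ := by
    have inner : (T - S) + (T - S) * S⁻¹ * (T - S) = T * S⁻¹ * T - T := by
      simp only [sub_mul, mul_sub, mul_nonsing_inv S hSdet, one_mul,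
        nonsing_inv_mul_cancel_right S T hSdet]
      abel
    rw [inner, mul_sub, sub_mul, nonsing_inv_mul T hTdet, one_mul,
      Matrix.mul_assoc T, nonsing_inv_mul_cancel_left T _ hTdet,
      mul_nonsing_inv_cancel_right T _ hTdet]
  have hD : ((T - S) * S⁻¹ * (T - S)).PosSemidef := by
    have := hS.inv.posSemidef.conjTranspose_mul_mul_same (T - S)
    rwa [h.isHermitian.eq] at this
  have := (h.add hD).conjTranspose_mul_mul_same T⁻¹
  rwa [hT.inv.isHermitian.eq, ← key] at this

theorem Matrix.sub_mul_inv_add_mul_eq {n : Type*} [Fintype n] [DecidableEq n]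
    {X P : Matrix n n ℝ} (h : IsUnit (X + P).det) :
    X - X * (X + P)⁻¹ * X = P - P * (X + P)⁻¹ * P := by
  obtain ⟨S, hS⟩ : ∃ S, S = X + P := ⟨_, rfl⟩
  obtain rfl : X = S - P := by rw [hS, add_sub_cancel_right]
  rw [sub_add_cancel] at h ⊢
  simp only [sub_mul, mul_sub, mul_nonsing_inv S h, one_mul,
    nonsing_inv_mul_cancel_right S P h]
  abel

theorem psi_mono {m : ℕ} {A Q X Y : Matrix (Fin m) (Fin m) ℝ} (hA : IsUnit A.det)
    (hQ : Q.PosDef) (hX : X.PosSemidef) (hY : Y.PosSemidef) (h : (Y - X).PosSemidef) :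
    (psi A Q Y - psi A Q X).PosSemidef := by
  have hP : (Aᵀ * Q⁻¹ * A).PosDef := by
    have := hQ.inv.conjTranspose_mul_mul_same (mulVec_injective_of_isUnit
      ((isUnit_iff_isUnit_det A).2 hA))
    rwa [conjTranspose_eq_transpose_of_trivial] at this
  set P := Aᵀ * Q⁻¹ * A with hPdef
  have hXP : (X + P).PosDef := hP.posSemidef_add hX
  have hYP : (Y + P).PosDef := hP.posSemidef_add hY
  have psi_eq {Z : Matrix (Fin m) (Fin m) ℝ} (hZ : (Z + P).PosDef) :
      psi A Q Z = (A⁻¹)ᵀ * (P - P * (Z + P)⁻¹ * P) * A⁻¹ := by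
    rw [← sub_mul_inv_add_mul_eq ((isUnit_iff_isUnit_det _).1 hZ.isUnit), psi, ← hPdef]
    simp only [mul_sub, sub_mul, Matrix.mul_assoc]
  have hinv : ((X + P)⁻¹ - (Y + P)⁻¹).PosSemidef :=
    hXP.posSemidef_inv_sub_inv_s9 hYP (by rwa [add_sub_add_right_eq_sub])
  have hmul := (hinv.conjTranspose_mul_mul_same P).conjTranspose_mul_mul_same A⁻¹
  rw [hP.isHermitian.eq, conjTranspose_eq_transpose_of_trivial] at hmul
  convert hmul using 1
  rw [psi_eq hXP, psi_eq hYP, ← sub_mul, ← mul_sub, sub_sub_sub_cancel_left,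
    mul_sub P, sub_mul _ _ P]

theorem stmt_9 {m : ℕ} (A : ℕ → Matrix (Fin m) (Fin m) ℝ)
    (Q : Matrix (Fin m) (Fin m) ℝ) (l : ℕ → Matrix (Fin m) (Fin m) ℝ)
    (hA : ∀ k, IsUnit (A k).det) (hQ : Q.PosDef) (hl : ∀ k, (l k).PosSemidef)
    (I J : ℕ → Matrix (Fin m) (Fin m) ℝ)
    (hI : ∀ k, (I k).PosSemidef) (hJ : ∀ k, (J k).PosSemidef)
    (h0 : (J 0 - I 0).PosSemidef)
    (hIrec : ∀ k, I (k + 1) = psi (A k) Q (I k + l k))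
    (hJrec : ∀ k, J (k + 1) = psi (A k) Q (J k + l k)) :
    ∀ k, (J k - I k).PosSemidef := by
  intro k
  induction k with
  | zero => exact h0
  | succ k ih =>
    rw [hIrec, hJrec]
    exact psi_mono (hA k) hQ ((hI k).add (hl k)) ((hJ k).add (hl k))
      (by rwa [add_sub_add_right_eq_sub])
end

section
/- (Theorem 1, deterministic form: the information matrix lower-bounds the inverse error covariance.) Let A : ℕ → ℝ^{m×m} be a sequence of invertible matrices, Q ∈ ℝ^{m×m} positive definite, and l : ℕ → ℝ^{m×m} a sequence of positive semidefinite matrices. Define the information-matrix sequence I : ℕ → ℝ^{m×m} by I₀ = 0 and I_{k+1} = ψ_{A(k),Q}(I_k + l_k), and define the error-covariance sequences by: P₀ ∈ ℝ^{m×m} positive definite, Σ_k = (P_k⁻¹ + l_k)⁻¹, and P_{k+1} = A(k) Σ_k A(k)ᵀ + Q. Then every P_k and Σ_k is positive definite, and for all k ∈ ℕ: I_k ⪯ P_k⁻¹ and I_k + l_k ⪯ Σ_k⁻¹ in the Loewner order. -/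
open Matrix

section MatrixLemmas

variable {n : Type*} [Fintype n] [DecidableEq n]

/-- Matrix inversion is antitone on positive definite matrices for the Loewner order. -/
theorem Matrix.PosDef.posSemidef_inv_sub_inv_s10 {X Y : Matrix n n ℝ} (hX : X.PosDef)
    (hY : Y.PosDef) (h : (Y - X).PosSemidef) : (X⁻¹ - Y⁻¹).PosSemidef := by
  have hXdet : IsUnit X.det := (isUnit_iff_isUnit_det X).1 hX.isUnit
  let := hY.isUnit.invertible
  let := hX.inv.isUnit.invertible
  have key := (hY.fromBlocks₁₁ (1 : Matrix n n ℝ) X⁻¹).1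
    ((hX.inv.fromBlocks₂₂ Y (1 : Matrix n n ℝ)).2 (by
      simpa [nonsing_inv_nonsing_inv X hXdet] using h))
  simpa using key

theorem Matrix.PosDef.transpose_mul_mul_same {Q A : Matrix n n ℝ} (hQ : Q.PosDef)
    (hA : IsUnit A.det) : (Aᵀ * Q * A).PosDef := by
  simpa [star_eq_conjTranspose, conjTranspose_eq_transpose_of_trivial] using
    (IsUnit.posDef_star_left_conjugate_iff ((isUnit_iff_isUnit_det A).2 hA)).2 hQ

end MatrixLemmas

section Prediction

variable {m : ℕ} {A Q J K M : Matrix (Fin m) (Fin m) ℝ}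

/-- The prediction map in the form suggested by the Woodbury identity. -/
theorem psi_eq_inv_sub (hA : IsUnit A.det) (hD : IsUnit (J + Aᵀ * Q⁻¹ * A).det) :
    psi A Q J = Q⁻¹ - Q⁻¹ * A * (J + Aᵀ * Q⁻¹ * A)⁻¹ * (Aᵀ * Q⁻¹) := by
  have hAt : IsUnit Aᵀ.det := by rwa [det_transpose]
  set D := J + Aᵀ * Q⁻¹ * A with hDdef
  set N := Aᵀ * Q⁻¹ * A with hN
  have hJ : J = D - N := by rw [hDdef]; abel
  have hpar : J - J * D⁻¹ * J = N - N * D⁻¹ * N := by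
    rw [hJ]
    simp only [sub_mul, mul_sub, mul_nonsing_inv D hD, one_mul, mul_assoc,
      nonsing_inv_mul D hD, mul_one]
    abel
  have hleft : (A⁻¹)ᵀ * N = Q⁻¹ * A := by
    rw [hN, transpose_nonsing_inv, mul_assoc, nonsing_inv_mul_cancel_left _ _ hAt]
  have hright : N * A⁻¹ = Aᵀ * Q⁻¹ := by
    rw [hN, mul_nonsing_inv_cancel_right _ _ hA]
  calc psi A Q J = (A⁻¹)ᵀ * (J - J * D⁻¹ * J) * A⁻¹ := by
        simp only [psi, mul_sub, sub_mul, mul_assoc, ← hN, ← hDdef]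
    _ = (A⁻¹)ᵀ * N * A⁻¹ - (A⁻¹)ᵀ * N * D⁻¹ * (N * A⁻¹) := by
        rw [hpar]; simp only [mul_sub, sub_mul, mul_assoc]
    _ = _ := by
        rw [hleft, hright, mul_nonsing_inv_cancel_right _ _ hA]

/-- The prediction map is monotone on positive semidefinite matrices. -/
theorem psi_mono_s10 (hA : IsUnit A.det) (hQ : Q.PosDef) (hJ : J.PosSemidef) (hK : K.PosSemidef)
    (h : (K - J).PosSemidef) : (psi A Q K - psi A Q J).PosSemidef := by
  have hN : (Aᵀ * Q⁻¹ * A).PosDef := hQ.inv.transpose_mul_mul_same hA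
  have hDJ : (J + Aᵀ * Q⁻¹ * A).PosDef := PosDef.posSemidef_add hJ hN
  have hDK : (K + Aᵀ * Q⁻¹ * A).PosDef := PosDef.posSemidef_add hK hN
  have hinv := hDJ.posSemidef_inv_sub_inv_s10 hDK (by simpa using h)
  have hconj := hinv.mul_mul_conjTranspose_same (Q⁻¹ * A)
  have hQt : (Q⁻¹)ᵀ = Q⁻¹ := by
    simpa [conjTranspose_eq_transpose_of_trivial] using hQ.inv.isHermitian.eq
  rw [conjTranspose_eq_transpose_of_trivial, transpose_mul, hQt] at hconj
  rw [psi_eq_inv_sub hA ((isUnit_iff_isUnit_det _).1 hDJ.isUnit),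
    psi_eq_inv_sub hA ((isUnit_iff_isUnit_det _).1 hDK.isUnit), sub_sub_sub_cancel_left,
    ← sub_mul, ← mul_sub]
  exact hconj

theorem psi_zero : psi A Q 0 = 0 := by
  simp [psi]

theorem psi_posSemidef (hA : IsUnit A.det) (hQ : Q.PosDef) (hJ : J.PosSemidef) :
    (psi A Q J).PosSemidef := by
  simpa [psi_zero] using psi_mono_s10 hA hQ PosSemidef.zero hJ (by simpa using hJ)

/-- On positive definite information matrices the prediction map is the inverse of the
covariance prediction. -/
theorem psi_inv (hA : IsUnit A.det) (hQ : Q.PosDef) (hM : M.PosDef) :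
    psi A Q M⁻¹ = (A * M * Aᵀ + Q)⁻¹ := by
  have hD : (M⁻¹ + Aᵀ * Q⁻¹ * A).PosDef := hM.inv.add (hQ.inv.transpose_mul_mul_same hA)
  rw [psi_eq_inv_sub hA ((isUnit_iff_isUnit_det _).1 hD.isUnit), add_comm (A * M * Aᵀ),
    add_mul_mul_inv_eq_sub Q A M Aᵀ hQ.isUnit hM.isUnit hD.isUnit]
  simp only [mul_assoc]

end Prediction

theorem stmt_10 {m : ℕ} (A : ℕ → Matrix (Fin m) (Fin m) ℝ)
    (Q : Matrix (Fin m) (Fin m) ℝ) (l : ℕ → Matrix (Fin m) (Fin m) ℝ)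
    (hA : ∀ k, IsUnit (A k).det) (hQ : Q.PosDef) (hl : ∀ k, (l k).PosSemidef)
    (I : ℕ → Matrix (Fin m) (Fin m) ℝ)
    (hI0 : I 0 = 0)
    (hIrec : ∀ k, I (k + 1) = psi (A k) Q (I k + l k))
    (P S : ℕ → Matrix (Fin m) (Fin m) ℝ)
    (hP0 : (P 0).PosDef)
    (hS : ∀ k, S k = ((P k)⁻¹ + l k)⁻¹)
    (hPrec : ∀ k, P (k + 1) = A k * S k * (A k)ᵀ + Q) :
    (∀ k, (P k).PosDef ∧ (S k).PosDef) ∧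
      (∀ k, ((P k)⁻¹ - I k).PosSemidef ∧ ((S k)⁻¹ - (I k + l k)).PosSemidef) := by
  have hSpos : ∀ k, (P k).PosDef → (S k).PosDef := fun k hk => by
    rw [hS k]
    exact (hk.inv.add_posSemidef (hl k)).inv
  have hPpos : ∀ k, (P k).PosDef := by
    intro k
    induction k with
    | zero => exact hP0
    | succ k ih =>
      rw [hPrec k]
      refine PosDef.posSemidef_add ?_ hQ
      simpa [conjTranspose_eq_transpose_of_trivial] using
        (hSpos k ih).posSemidef.mul_mul_conjTranspose_same (A k)
  have hSinv : ∀ k, (S k)⁻¹ = (P k)⁻¹ + l k := fun k => by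
    rw [hS k, nonsing_inv_nonsing_inv]
    exact (isUnit_iff_isUnit_det _).1 ((hPpos k).inv.add_posSemidef (hl k)).isUnit
  have hIpos : ∀ k, (I k).PosSemidef := by
    intro k
    induction k with
    | zero => rw [hI0]; exact PosSemidef.zero
    | succ k ih =>
      rw [hIrec k]
      exact psi_posSemidef (hA k) hQ (ih.add (hl k))
  have hpost : ∀ k, ((P k)⁻¹ - I k).PosSemidef → ((S k)⁻¹ - (I k + l k)).PosSemidef :=
    fun k hk => by rwa [hSinv k, add_sub_add_right_eq_sub]
  have hprior : ∀ k, ((P k)⁻¹ - I k).PosSemidef := by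
    intro k
    induction k with
    | zero => simpa [hI0] using hP0.inv.posSemidef
    | succ k ih =>
      have hSk := hSpos k (hPpos k)
      rw [hPrec k, hIrec k, ← psi_inv (hA k) hQ hSk]
      exact psi_mono_s10 (hA k) hQ ((hIpos k).add (hl k)) hSk.inv.posSemidef (hpost k ih)
  exact ⟨fun k => ⟨hPpos k, hSpos k (hPpos k)⟩, fun k => ⟨hprior k, hpost k (hprior k)⟩⟩
end
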